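/- Let ρ = (ρ_n)_{n≥1} be a state and let s ∈ [0,1] satisfy s > liminf_n H(ρ_n)/n. Then there exist δ > 0, a sequence of natural numbers (n_m)_{m≥1}, and Hermitian projections S^m on ℂ^{2^{n_m}} such that ∑_{m≥1} 2^{-s·n_m}·Tr(S^m) < ∞ and Tr(ρ_{n_m}·S^m) > δ for every m. (This is the analytic content of the theorem that a computable state ρ with s > H(ρ) is covered by a quantum s-test.) -/

import Mathlib

open Matrix Filter MeasureTheory
open scoped ComplexOrder

/-- Von Neumann entropy of a Hermitian matrix: the Shannon entropy (base 2) of its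
eigenvalue distribution, with the convention `0 * log₂ 0 = 0` (automatic since
`Real.logb 2 0 = 0`). -/
noncomputable def vnEntropy {ι : Type} [Fintype ι] [DecidableEq ι]
    {A : Matrix ι ι ℂ} (hA : A.IsHermitian) : ℝ :=
  -∑ i, hA.eigenvalues i * Real.logb 2 (hA.eigenvalues i)

/-- A state: a sequence `ρ n` of density matrices on `ℂ^(2^n)` (rows and columns indexed by
length-`n` bitstrings) satisfying the partial-trace coherence condition. -/
structure QState where
  M : (n : ℕ) → Matrix (Fin n → Bool) (Fin n → Bool) ℂ
  posSemidef : ∀ n, (M n).PosSemidef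
  trace_one : ∀ n, (M n).trace = 1
  coherent : ∀ n (σ σ' : Fin n → Bool),
    M n σ σ' = M (n + 1) (Fin.snoc σ false) (Fin.snoc σ' false)
             + M (n + 1) (Fin.snoc σ true) (Fin.snoc σ' true)

/-- The von Neumann entropy of the length-`n` initial segment of a state. -/
noncomputable def QState.entropy (ρ : QState) (n : ℕ) : ℝ :=
  vnEntropy (ρ.posSemidef n).1

/-- The spectral projection of a Hermitian matrix onto the eigenvectors indexed by `T`. -/
theorem exists_spectral_projection {ι : Type} [Fintype ι] [DecidableEq ι]
    {A : Matrix ι ι ℂ} (hA : A.IsHermitian) (T : Finset ι) :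
    ∃ P : Matrix ι ι ℂ, (P.IsHermitian ∧ P * P = P) ∧ P.trace.re = T.card ∧
      (A * P).trace.re = ∑ i ∈ T, hA.eigenvalues i := by
  set D : Matrix ι ι ℂ := diagonal fun i => if i ∈ T then 1 else 0 with hD
  set φ := Unitary.conjStarAlgAut ℂ _ hA.eigenvectorUnitary with hφ
  have trace_φ (B : Matrix ι ι ℂ) : (φ B).trace = B.trace := by
    rw [hφ, Unitary.conjStarAlgAut_apply, trace_mul_comm, ← mul_assoc]
    simp
  refine ⟨φ D, ⟨?_, ?_⟩, ?_, ?_⟩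
  · have hDs : star D = D := by
      rw [star_eq_conjTranspose, hD, diagonal_conjTranspose]
      congr 1
      ext i
      by_cases h : i ∈ T <;> simp [h]
    change star (φ D) = φ D
    rw [← map_star, hDs]
  · rw [← map_mul, hD, diagonal_mul_diagonal]
    simp
  · rw [trace_φ, hD, trace_diagonal]
    simp
  · have hAD : A * φ D = φ (diagonal (RCLike.ofReal ∘ hA.eigenvalues) * D) := by
      rw [map_mul, hφ, ← hA.spectral_theorem]
    rw [hAD, trace_φ, hD, diagonal_mul_diagonal, trace_diagonal]
    simp [Finset.sum_ite_mem]

theorem sum_eigenvalues_eq_one {ι : Type} [Fintype ι] [DecidableEq ι]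
    {A : Matrix ι ι ℂ} (hA : A.IsHermitian) (htr : A.trace = 1) :
    ∑ i, hA.eigenvalues i = 1 := by
  have h := congrArg Complex.re hA.trace_eq_sum_eigenvalues
  rw [htr] at h
  simpa using h.symm

theorem mul_logb_two_nonpos {x : ℝ} (h0 : 0 ≤ x) (h1 : x ≤ 1) : x * Real.logb 2 x ≤ 0 :=
  mul_nonpos_of_nonneg_of_nonpos h0 (Real.logb_nonpos one_lt_two h0 h1)

/-- Shannon entropy is at most the logarithm of the size of the alphabet. -/
theorem neg_sum_mul_logb_le {ι : Type} [Fintype ι] {p : ι → ℝ} (hp : ∀ i, 0 ≤ p i)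
    (hsum : ∑ i, p i = 1) : -∑ i, p i * Real.logb 2 (p i) ≤ Real.logb 2 (Fintype.card ι) := by
  have hne : Nonempty ι := by
    by_contra h
    rw [not_nonempty_iff] at h
    simp at hsum
  have hN : (0 : ℝ) < Fintype.card ι := by exact_mod_cast Fintype.card_pos
  have hlog : (0 : ℝ) < Real.log 2 := Real.log_pos one_lt_two
  have key (i : ι) : -(p i * Real.log (p i)) ≤
      p i * Real.log (Fintype.card ι) + ((Fintype.card ι : ℝ)⁻¹ - p i) := by
    rcases (hp i).eq_or_lt with h | h
    · simp [← h]
    · have hl := Real.log_le_sub_one_of_pos (x := (Fintype.card ι : ℝ)⁻¹ / p i) (by positivity)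
      rw [Real.log_div (by positivity) h.ne', Real.log_inv] at hl
      have hm := mul_le_mul_of_nonneg_left hl h.le
      have hd : p i * ((Fintype.card ι : ℝ)⁻¹ / p i - 1) = (Fintype.card ι : ℝ)⁻¹ - p i := by
        field_simp
      linarith
  have hs := Finset.sum_le_sum fun i (_ : i ∈ Finset.univ) => key i
  rw [Finset.sum_add_distrib, ← Finset.sum_mul, Finset.sum_sub_distrib, hsum,
    Finset.sum_neg_distrib] at hs
  simp only [Finset.sum_const, Finset.card_univ, nsmul_eq_mul, mul_inv_cancel₀ hN.ne'] at hs
  simp only [Real.logb, ← mul_div_assoc, ← Finset.sum_div, ← neg_div]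
  gcongr
  linarith

/-- A Markov-type bound: a distribution of entropy less than `b` has a set of at most `2 ^ c`
outcomes of total mass more than `1 - b / c`. -/
theorem exists_finset_card_le_and_lt_sum {ι : Type} [Fintype ι] {p : ι → ℝ}
    (hp : ∀ i, 0 ≤ p i) (hsum : ∑ i, p i = 1) {b c : ℝ} (hc : 0 < c)
    (hb : -∑ i, p i * Real.logb 2 (p i) < b) :
    ∃ T : Finset ι, (T.card : ℝ) ≤ 2 ^ c ∧ 1 - b / c < ∑ i ∈ T, p i := by
  classical
  have hp1 (i : ι) : p i ≤ 1 :=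
    hsum ▸ Finset.single_le_sum (fun j _ => hp j) (Finset.mem_univ i)
  have h2c : (0 : ℝ) < 2 ^ c := by positivity
  have hsplit := Finset.sum_filter_add_sum_filter_not Finset.univ (fun i => 2 ^ (-c) ≤ p i) p
  refine ⟨Finset.univ.filter fun i => 2 ^ (-c) ≤ p i, ?_, ?_⟩
  · have h := Finset.card_nsmul_le_sum (Finset.univ.filter fun i => 2 ^ (-c) ≤ p i) p (2 ^ (-c))
      (by simp)
    have hle : (((Finset.univ.filter fun i => 2 ^ (-c) ≤ p i).card : ℕ) : ℝ) * (2 ^ c)⁻¹ ≤ 1 := by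
      rw [← Real.rpow_neg zero_le_two, ← nsmul_eq_mul]
      have := Finset.sum_nonneg fun i (_ : i ∈ Finset.univ.filter fun i => ¬2 ^ (-c) ≤ p i) => hp i
      linarith
    rwa [mul_inv_le_iff₀ h2c, one_mul] at hle
  · have htail : c * ∑ i with ¬2 ^ (-c) ≤ p i, p i ≤ -∑ i, p i * Real.logb 2 (p i) := by
      rw [Finset.mul_sum, ← Finset.sum_neg_distrib]
      refine (Finset.sum_le_sum fun i hi => ?_).trans
        (Finset.sum_le_sum_of_subset_of_nonneg (Finset.filter_subset _ _) fun i _ _ =>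
          neg_nonneg.2 (mul_logb_two_nonpos (hp i) (hp1 i)))
      rcases (hp i).eq_or_lt with h | h
      · simp [← h]
      · have hlt : Real.logb 2 (p i) < -c :=
          (Real.logb_lt_iff_lt_rpow one_lt_two h).2 (by simpa using hi)
        nlinarith
    have : ∑ i with ¬2 ^ (-c) ≤ p i, p i < b / c := by
      rw [lt_div_iff₀ hc]
      linarith
    linarith

namespace QState

theorem entropy_nonneg (ρ : QState) (n : ℕ) : 0 ≤ ρ.entropy n := by
  have hp := (ρ.posSemidef n).eigenvalues_nonneg
  have hsum := sum_eigenvalues_eq_one (ρ.posSemidef n).1 (ρ.trace_one n)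
  refine neg_nonneg.2 (Finset.sum_nonpos fun i _ => mul_logb_two_nonpos (hp i) ?_)
  exact hsum ▸ Finset.single_le_sum (fun j _ => hp j) (Finset.mem_univ i)

theorem entropy_le (ρ : QState) (n : ℕ) : ρ.entropy n ≤ n := by
  have h := neg_sum_mul_logb_le (ρ.posSemidef n).eigenvalues_nonneg
    (sum_eigenvalues_eq_one (ρ.posSemidef n).1 (ρ.trace_one n))
  have hcard : Real.logb 2 (Fintype.card (Fin n → Bool)) = n := by
    simp [Real.logb_pow]
  rwa [hcard] at h

theorem isCoboundedUnder_entropy_div (ρ : QState) :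
    IsCoboundedUnder (· ≥ ·) atTop fun n : ℕ => ρ.entropy n / n :=
  isCoboundedUnder_ge_of_eventually_le (x := 1) atTop <| Eventually.of_forall fun n =>
    div_le_one_of_le₀ (ρ.entropy_le n) n.cast_nonneg

end QState

/-- If `s ∈ [0,1]` exceeds the entropy rate `liminf_n H(ρ_n)/n` of a
state `ρ`, then `ρ` is covered by a quantum s-test: there are `δ > 0`, a sequence
`n_m`, and Hermitian projections `S^m` on `ℂ^(2^(n_m))` such that
`∑_m 2^(-s·n_m)·Tr(S^m) < ∞` and `Tr(ρ_(n_m)·S^m) > δ` for every `m`. -/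
theorem covered_by_quantum_s_test (ρ : QState) (s : ℝ)
    (hs0 : 0 ≤ s) (hs1 : s ≤ 1)
    (hs : Filter.liminf (fun n : ℕ => ρ.entropy n / n) Filter.atTop < s) :
    ∃ δ > (0 : ℝ), ∃ nm : ℕ → ℕ,
      ∃ S : (m : ℕ) → Matrix (Fin (nm m) → Bool) (Fin (nm m) → Bool) ℂ,
        (∀ m, (S m).IsHermitian ∧ S m * S m = S m) ∧
        Summable (fun m => (2 : ℝ) ^ (-(s * (nm m : ℝ))) * ((S m).trace).re) ∧
        ∀ m, δ < ((ρ.M (nm m) * S m).trace).re := by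
  obtain ⟨t, hlt, hts⟩ := exists_between hs
  obtain ⟨r, htr, hrs⟩ := exists_between hts
  have hfreq := (frequently_lt_of_liminf_lt ρ.isCoboundedUnder_entropy_div hlt).and_eventually
    (eventually_gt_atTop 0)
  obtain ⟨nm, hmono, hnm⟩ := extraction_of_frequently_atTop hfreq
  have ht : 0 < t := (div_nonneg (ρ.entropy_nonneg _) (Nat.cast_nonneg _)).trans_lt (hnm 0).1
  have hr : 0 < r := ht.trans htr
  have key (m : ℕ) : ∃ P : Matrix (Fin (nm m) → Bool) (Fin (nm m) → Bool) ℂ,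
      (P.IsHermitian ∧ P * P = P) ∧ (0 ≤ P.trace.re ∧ P.trace.re ≤ 2 ^ (r * nm m)) ∧
        1 - t / r < (ρ.M (nm m) * P).trace.re := by
    have hn : (0 : ℝ) < nm m := by exact_mod_cast (hnm m).2
    obtain ⟨T, hcard, hT⟩ := exists_finset_card_le_and_lt_sum
      (ρ.posSemidef (nm m)).eigenvalues_nonneg
      (sum_eigenvalues_eq_one (ρ.posSemidef (nm m)).1 (ρ.trace_one (nm m)))
      (mul_pos hr hn) ((div_lt_iff₀ hn).1 (hnm m).1)
    obtain ⟨P, hP, htrace, hmass⟩ := exists_spectral_projection (ρ.posSemidef (nm m)).1 T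
    refine ⟨P, hP, ⟨?_, ?_⟩, ?_⟩
    · rw [htrace]
      positivity
    · rwa [htrace]
    · rwa [hmass, ← mul_div_mul_right t r hn.ne']
  choose S hS htrace hmass using key
  refine ⟨1 - t / r, sub_pos.2 ((div_lt_one hr).2 htr), nm, S, hS, ?_, hmass⟩
  have hq : (2 : ℝ) ^ (-(s - r)) < 1 :=
    Real.rpow_lt_one_of_one_lt_of_neg one_lt_two (by linarith)
  refine Summable.of_nonneg_of_le (fun m => mul_nonneg (by positivity) (htrace m).1) (fun m => ?_)
    (summable_geometric_of_lt_one (by positivity) hq)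
  calc (2 : ℝ) ^ (-(s * (nm m : ℝ))) * (S m).trace.re
      ≤ 2 ^ (-(s * (nm m : ℝ))) * 2 ^ (r * nm m) := by
        gcongr
        exact (htrace m).2
    _ = 2 ^ (-(s - r) * nm m) := by
        rw [← Real.rpow_add two_pos]
        ring_nf
    _ = (2 ^ (-(s - r))) ^ nm m := by
        rw [Real.rpow_mul zero_le_two, Real.rpow_natCast]
    _ ≤ (2 ^ (-(s - r))) ^ m :=
        pow_le_pow_of_le_one (by positivity) hq.le hmono.le_apply
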